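/- Let (Ω, 𝓕, P) be a probability space, 𝓖 ⊆ 𝓕 a sub-σ-algebra, U : Ω → [0,1] a 𝓖-measurable random variable, V a random variable uniformly distributed on [0,1] and independent of 𝓖, α ∈ [0,1], and ρ ∈ (−1,1). Then E[(1 − α)·U + α·H_ρ(U, V) | 𝓖] = U almost surely. -/

import Mathlib

open MeasureTheory ProbabilityTheory

/-- The standard normal cumulative distribution function `Φ`. -/
noncomputable def Phi (t : ℝ) : ℝ := ((gaussianReal 0 1) (Set.Iic t)).toReal

/-- The inverse (quantile function) of the standard normal CDF. -/
noncomputable def PhiInv (u : ℝ) : ℝ := sInf {x : ℝ | u ≤ Phi x}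

/-- The Gaussian copula update function `H_ρ(u,v)`, extended by `H_ρ(0,v) = 0` and
`H_ρ(1,v) = 1`. -/
noncomputable def Hcop (ρ u v : ℝ) : ℝ :=
  if u = 0 then 0
  else if u = 1 then 1
  else Phi ((PhiInv u - ρ * PhiInv v) / Real.sqrt (1 - ρ ^ 2))

open Set Filter Topology

lemma Phi_eq_cdf (t : ℝ) : Phi t = cdf (gaussianReal 0 1) t := by
  rw [cdf_eq_real]; rfl

lemma Phi_mono : Monotone Phi := fun a b h => by
  simpa only [Phi_eq_cdf] using monotone_cdf _ h

lemma Phi_nonneg (t : ℝ) : 0 ≤ Phi t := ENNReal.toReal_nonneg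

lemma Phi_le_one (t : ℝ) : Phi t ≤ 1 := by
  simpa only [Phi_eq_cdf] using cdf_le_one _ t

lemma ofReal_Phi (t : ℝ) : ENNReal.ofReal (Phi t) = gaussianReal 0 1 (Iic t) :=
  ENNReal.ofReal_toReal (measure_ne_top _ _)

lemma continuous_Phi : Continuous Phi := by
  have := nullSingletonClass_gaussianReal (μ := 0) (v := 1) one_ne_zero
  have hP : Phi = cdf (gaussianReal 0 1) := funext Phi_eq_cdf
  rw [continuous_iff_continuousAt]
  intro x
  rw [hP, continuousAt_iff_continuous_left'_right']
  have h := StieltjesFunction.measure_singleton (cdf (gaussianReal 0 1)) x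
  rw [measure_cdf, measure_singleton, eq_comm, ENNReal.ofReal_eq_zero] at h
  constructor
  · rw [(monotone_cdf _).continuousWithinAt_Iio_iff_leftLim_eq]
    exact le_antisymm ((monotone_cdf _).leftLim_le le_rfl) (by linarith)
  · exact ((cdf (gaussianReal 0 1)).right_continuous x).mono Ioi_subset_Ici_self

lemma tendsto_Phi_atBot : Tendsto Phi atBot (𝓝 0) := by
  rw [funext Phi_eq_cdf]; exact tendsto_cdf_atBot _

lemma tendsto_Phi_atTop : Tendsto Phi atTop (𝓝 1) := by
  rw [funext Phi_eq_cdf]; exact tendsto_cdf_atTop _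

lemma PhiInv_le_iff {u : ℝ} (hu : u ∈ Ioo (0 : ℝ) 1) (x : ℝ) : PhiInv u ≤ x ↔ u ≤ Phi x := by
  have hbdd : BddBelow {x : ℝ | u ≤ Phi x} := by
    obtain ⟨b, hb⟩ := (tendsto_Phi_atBot.eventually_lt_const hu.1).exists
    exact ⟨b, fun y hy => le_of_not_gt fun h => absurd (Phi_mono h.le) (by
      have : u ≤ Phi y := hy
      linarith)⟩
  have hne : {x : ℝ | u ≤ Phi x}.Nonempty := by
    obtain ⟨b, hb⟩ := (tendsto_Phi_atTop.eventually_const_lt hu.2).exists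
    exact ⟨b, hb.le⟩
  have hcl : IsClosed {x : ℝ | u ≤ Phi x} := isClosed_le continuous_const continuous_Phi
  exact ⟨fun h => (hcl.csInf_mem hne hbdd : u ≤ Phi (PhiInv u)).trans (Phi_mono h),
    fun h => csInf_le hbdd h⟩

lemma Phi_PhiInv {u : ℝ} (hu : u ∈ Ioo (0 : ℝ) 1) : Phi (PhiInv u) = u := by
  refine le_antisymm ?_ ((PhiInv_le_iff hu _).1 le_rfl)
  refine le_of_tendsto (continuous_Phi.continuousWithinAt (s := Iio (PhiInv u))) ?_
  filter_upwards [self_mem_nhdsWithin] with y hy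
  exact le_of_not_ge fun h => absurd ((PhiInv_le_iff hu y).2 h) (not_le.2 hy)

lemma PhiInv_of_notMem {u : ℝ} (hu : u ∉ Ioo (0 : ℝ) 1) (h1 : u ≠ 1) : PhiInv u = 0 := by
  rcases le_or_gt u 0 with h | h
  · have : {x : ℝ | u ≤ Phi x} = univ := eq_univ_of_forall fun x => h.trans (Phi_nonneg x)
    rw [PhiInv, this, Real.sInf_univ]
  · have h1 : 1 < u := lt_of_le_of_ne (le_of_not_gt fun h1 => hu ⟨h, h1⟩) h1.symm
    have : {x : ℝ | u ≤ Phi x} = ∅ :=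
      eq_empty_of_forall_notMem fun x hx => absurd (h1.trans_le hx) (Phi_le_one x).not_gt
    rw [PhiInv, this, Real.sInf_empty]

lemma measurable_PhiInv : Measurable PhiInv := by
  have h : Measurable ((Ioo (0 : ℝ) 1).indicator PhiInv) := by
    refine measurable_of_Iic fun x => ?_
    have : (Ioo (0 : ℝ) 1).indicator PhiInv ⁻¹' Iic x
        = (Ioo 0 1 ∩ Iic (Phi x)) ∪ ((Ioo 0 1)ᶜ ∩ {_u | 0 ≤ x}) := by
      ext u
      by_cases hu : u ∈ Ioo (0 : ℝ) 1
      · simp [hu, PhiInv_le_iff hu, -mem_Ioo]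
      · simp [hu, -mem_Ioo]
    rw [this]
    exact (measurableSet_Ioo.inter measurableSet_Iic).union
      (measurableSet_Ioo.compl.inter (MeasurableSet.const _))
  refine h.measurable_of_countable_ne ((countable_singleton (1 : ℝ)).mono fun u hu => ?_)
  by_contra h1
  refine hu ?_
  by_cases hm : u ∈ Ioo (0 : ℝ) 1
  · simp [hm, -mem_Ioo]
  · rw [indicator_of_notMem hm, PhiInv_of_notMem hm h1]

lemma map_PhiInv_uniform :
    (volume.restrict (Icc (0 : ℝ) 1)).map PhiInv = gaussianReal 0 1 := by
  have : IsProbabilityMeasure (volume.restrict (Icc (0 : ℝ) 1)) := ⟨by simp⟩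
  have : IsProbabilityMeasure ((volume.restrict (Icc (0 : ℝ) 1)).map PhiInv) :=
    Measure.isProbabilityMeasure_map measurable_PhiInv.aemeasurable
  refine Measure.ext_of_Iic _ _ fun x => ?_
  rw [Measure.map_apply measurable_PhiInv measurableSet_Iic, ← restrict_Ioo_eq_restrict_Icc,
    Measure.restrict_apply (measurable_PhiInv measurableSet_Iic), ← ofReal_Phi]
  have : PhiInv ⁻¹' Iic x ∩ Ioo 0 1 = Ioo 0 1 ∩ Iic (Phi x) := by
    ext u
    simp only [mem_inter_iff, mem_preimage, mem_Iic]
    exact ⟨fun h => ⟨h.2, (PhiInv_le_iff h.2 x).1 h.1⟩, fun h => ⟨(PhiInv_le_iff h.1 x).2 h.2, h.1⟩⟩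
  rw [this, inter_comm, ← Measure.restrict_apply measurableSet_Iic, restrict_Ioo_eq_restrict_Ioc,
    Measure.restrict_apply measurableSet_Iic, inter_comm, Ioc_inter_Iic,
    min_eq_right (Phi_le_one x), Real.volume_Ioc, sub_zero]

lemma integral_Phi_gaussian {ρ : ℝ} (hρ : ρ ∈ Ioo (-1 : ℝ) 1) (a : ℝ) :
    ∫ z, Phi ((a - ρ * z) / √(1 - ρ ^ 2)) ∂gaussianReal 0 1 = Phi a := by
  have hs : 0 < √(1 - ρ ^ 2) := Real.sqrt_pos.2 (by nlinarith [hρ.1, hρ.2])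
  set s := √(1 - ρ ^ 2)
  have hs2 : s ^ 2 = 1 - ρ ^ 2 := Real.sq_sqrt (by nlinarith [hρ.1, hρ.2])
  have hconv : (gaussianReal 0 1).map (ρ * ·) ∗ (gaussianReal 0 1).map (s * ·)
      = gaussianReal 0 1 := by
    rw [gaussianReal_map_const_mul, gaussianReal_map_const_mul, gaussianReal_conv_gaussianReal]
    congr 1
    · simp
    · ext; simp [hs2]
  rw [integral_eq_lintegral_of_nonneg_ae (ae_of_all _ fun z => Phi_nonneg _)
    (by exact (Phi_mono.measurable.comp (by fun_prop)).aestronglyMeasurable)]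
  rw [Phi]
  congr 1
  conv_rhs => rw [← hconv]
  have hind : Measurable ((Iic a).indicator (1 : ℝ → ENNReal)) :=
    measurable_one.indicator measurableSet_Iic
  rw [← lintegral_indicator_one measurableSet_Iic, Measure.lintegral_conv hind,
    lintegral_map (Measurable.lintegral_prod_right
      (f := fun x y => (Iic a).indicator 1 (x + y)) (hind.comp measurable_add)) (by fun_prop)]
  refine lintegral_congr fun z => ?_
  rw [lintegral_map (f := fun y => (Iic a).indicator 1 (ρ * z + y))
    (hind.comp (measurable_const_add _)) (by fun_prop), ofReal_Phi,
    ← lintegral_indicator_one measurableSet_Iic]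
  refine lintegral_congr fun w => ?_
  simp only [indicator, mem_Iic, le_div_iff₀ hs]
  congr 1
  exact propext ⟨fun h => by linarith, fun h => by linarith⟩

lemma measurable_Hcop (ρ : ℝ) : Measurable fun p : ℝ × ℝ => Hcop ρ p.1 p.2 := by
  have h := measurable_PhiInv
  unfold Hcop
  refine Measurable.ite (measurable_fst (measurableSet_singleton 0)) measurable_const
    (Measurable.ite (measurable_fst (measurableSet_singleton 1)) measurable_const ?_)
  exact Phi_mono.measurable.comp (by fun_prop)

lemma Hcop_mem_Icc (ρ u v : ℝ) : Hcop ρ u v ∈ Icc (0 : ℝ) 1 := by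
  unfold Hcop
  split_ifs
  · simp
  · simp
  · exact ⟨Phi_nonneg _, Phi_le_one _⟩

lemma integral_Hcop {ρ : ℝ} (hρ : ρ ∈ Ioo (-1 : ℝ) 1) {u : ℝ} (hu : u ∈ Icc (0 : ℝ) 1) :
    ∫ v in Icc (0 : ℝ) 1, Hcop ρ u v = u := by
  by_cases h0 : u = 0
  · simp [Hcop, h0]
  by_cases h1 : u = 1
  · simp [Hcop, h1]
  simp only [Hcop, h0, h1, if_false]
  have hu' : u ∈ Ioo (0 : ℝ) 1 := ⟨lt_of_le_of_ne hu.1 (Ne.symm h0), lt_of_le_of_ne hu.2 h1⟩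
  conv_rhs => rw [← Phi_PhiInv hu', ← integral_Phi_gaussian hρ, ← map_PhiInv_uniform]
  rw [integral_map measurable_PhiInv.aemeasurable
    (by exact (Phi_mono.measurable.comp (by fun_prop)).aestronglyMeasurable)]

/-- If `Y` is independent of `X`, then conditioning a function of `(X, Y)` on `X` amounts to
integrating out `Y` against its law. -/
lemma condExp_prod_ae_eq_integral_map_of_indepFun {Ω β F : Type*} [MeasurableSpace Ω]
    [MeasurableSpace β] [MeasurableSpace F] [StandardBorelSpace F] [Nonempty F] {μ : Measure Ω}
    [IsFiniteMeasure μ] {X : Ω → β} {Y : Ω → F} (hX : Measurable X) (hY : Measurable Y)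
    (hXY : IndepFun X Y μ) {f : β × F → ℝ} (hf : StronglyMeasurable f)
    (hint : Integrable (fun ω => f (X ω, Y ω)) μ) :
    μ[fun ω => f (X ω, Y ω) | MeasurableSpace.comap X ‹MeasurableSpace β›]
      =ᵐ[μ] fun ω => ∫ y, f (X ω, y) ∂μ.map Y := by
  have hcd : condDistrib Y X μ =ᵐ[μ.map X] Kernel.const β (μ.map Y) := by
    refine condDistrib_ae_eq_of_measure_eq_compProd X hY.aemeasurable ?_
    rw [Measure.compProd_const, hXY.map_prod_eq_prod_map_map hX.aemeasurable hY.aemeasurable]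
  filter_upwards [condExp_prod_ae_eq_integral_condDistrib hX hY.aemeasurable hf hint,
    ae_of_ae_map hX.aemeasurable hcd] with ω h₁ h₂
  rw [h₁, h₂, Kernel.const_apply]

/-- If `U` is `𝓖`-measurable with values in `[0,1]`, `V` is uniform on `[0,1]` and
independent of `𝓖`, `α ∈ [0,1]` and `ρ ∈ (−1,1)`, then
`E[(1 − α)·U + α·H_ρ(U, V) | 𝓖] = U` almost surely. -/
theorem condexp_copula_update {Ω : Type*} {G : MeasurableSpace Ω}
    [mΩ : MeasurableSpace Ω] (hG : G ≤ mΩ)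
    (P : Measure Ω) [IsProbabilityMeasure P]
    (U : Ω → ℝ) (hUmeas : StronglyMeasurable[G] U)
    (hU01 : ∀ ω, U ω ∈ Set.Icc (0 : ℝ) 1)
    (V : Ω → ℝ) (hVmeas : Measurable[mΩ] V)
    (hVunif : P.map V = volume.restrict (Set.Icc (0 : ℝ) 1))
    (hindep : ProbabilityTheory.Indep (MeasurableSpace.comap V (borel ℝ)) G P)
    (α : ℝ) (hα : α ∈ Set.Icc (0 : ℝ) 1)
    (ρ : ℝ) (hρ : ρ ∈ Set.Ioo (-1 : ℝ) 1) :
    P[(fun ω => (1 - α) * U ω + α * Hcop ρ (U ω) (V ω)) | G] =ᵐ[P] U := by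
  have hUm : Measurable U := hUmeas.measurable.mono hG le_rfl
  have hX : Measurable[mΩ, G] (id : Ω → Ω) := measurable_id'' hG
  have hXV : @IndepFun Ω Ω ℝ mΩ G _ id V P := by
    refine (@IndepFun_iff_Indep Ω Ω ℝ mΩ G _ id V P).2 ?_
    rw [MeasurableSpace.comap_id, BorelSpace.measurable_eq (α := ℝ)]
    exact hindep.symm
  have hf : StronglyMeasurable[G.prod inferInstance]
      fun p : Ω × ℝ => (1 - α) * U p.1 + α * Hcop ρ (U p.1) p.2 := by
    let := G
    have hU : Measurable fun p : Ω × ℝ => U p.1 := hUmeas.measurable.comp measurable_fst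
    exact ((hU.const_mul _).add (((measurable_Hcop ρ).comp
      (hU.prodMk measurable_snd)).const_mul _)).stronglyMeasurable
  have hint : Integrable (fun ω => (1 - α) * U ω + α * Hcop ρ (U ω) (V ω)) P :=
    ((Integrable.of_mem_Icc 0 1 hUm.aemeasurable (ae_of_all _ hU01)).const_mul _).add
      ((Integrable.of_mem_Icc 0 1 ((measurable_Hcop ρ).comp (hUm.prodMk hVmeas)).aemeasurable
        (ae_of_all _ fun _ => Hcop_mem_Icc ρ _ _)).const_mul _)
  have key := @condExp_prod_ae_eq_integral_map_of_indepFun Ω Ω ℝ mΩ G _ _ _ P _ id V hX hVmeas hXV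
    _ hf hint
  rw [MeasurableSpace.comap_id] at key
  refine key.trans (ae_of_all _ fun ω => ?_)
  have hH : Integrable (fun v => Hcop ρ (U ω) v) (volume.restrict (Icc (0 : ℝ) 1)) :=
    Integrable.of_mem_Icc 0 1 ((measurable_Hcop ρ).comp measurable_prodMk_left).aemeasurable
      (ae_of_all _ fun _ => Hcop_mem_Icc ρ _ _)
  simp only [id, hVunif]
  rw [integral_add (integrable_const _) (hH.const_mul _), integral_const_mul, integral_const_mul α,
    integral_Hcop hρ (hU01 ω)]
  simp
  ring
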